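/- Let F be a field of characteristic different from 2. The map sending a quadruple (a, b, z, w) ∈ (F^×)⁴ to the Brauer class [(a,b)_F] + [(z,w)_F] ∈ Br(F) hits exactly the classes of central simple algebras of degree 4 and exponent dividing 2 (Albert's theorem): every central simple F-algebra of degree 4 and exponent ≤ 2 is isomorphic to a tensor product of two quaternion algebras. -/

import Mathlib

open Quaternion TensorProduct


/-- Skolem–Noether for matrix algebras. -/
theorem matrix_skolem {F : Type*} [Field F] {n : Type*} [Fintype n] [DecidableEq n] [Nonempty n]
    (θ : Matrix n n F ≃ₐ[F] Matrix n n F) :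
    ∃ g g' : Matrix n n F, g * g' = 1 ∧ g' * g = 1 ∧ ∀ M, θ M = g * M * g' := by
  classical
  obtain ⟨i0⟩ := ‹Nonempty n›
  have hne : θ (Matrix.single i0 i0 1) ≠ 0 := by
    intro h
    rw [map_eq_zero_iff _ θ.injective] at h
    have := congrFun (congrFun h i0) i0
    simp at this
  obtain ⟨u, hu⟩ : ∃ u : n → F, (θ (Matrix.single i0 i0 1)).mulVec u ≠ 0 := by
    by_contra! hcon
    exact hne (Matrix.ext_of_mulVec_single fun j => by rw [hcon, Matrix.zero_mulVec])
  let T : (n → F) →ₗ[F] (n → F) :=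
    { toFun := fun v => (θ (Matrix.vecMulVec v (Pi.single i0 1))).mulVec u
      map_add' := fun v w => by rw [Matrix.add_vecMulVec, map_add, Matrix.add_mulVec]
      map_smul' := fun c v => by
        rw [Matrix.smul_vecMulVec, map_smul, Matrix.smul_mulVec]; rfl }
  have hT : ∀ (M : Matrix n n F) v, T (M.mulVec v) = (θ M).mulVec (T v) := by
    intro M v
    change (θ (Matrix.vecMulVec (M.mulVec v) (Pi.single i0 1))).mulVec u = _
    rw [← Matrix.mul_vecMulVec, map_mul, ← Matrix.mulVec_mulVec]
    rfl
  have hT0 : T (Pi.single i0 1) ≠ 0 := by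
    change (θ (Matrix.vecMulVec (Pi.single i0 1) (Pi.single i0 1))).mulVec u ≠ 0
    rwa [Matrix.single_eq_single_vecMulVec_single] at hu
  have hinj : Function.Injective T := by
    rw [← LinearMap.ker_eq_bot, LinearMap.ker_eq_bot']
    intro v hv
    by_contra hv0
    obtain ⟨j, hj⟩ : ∃ j, v j ≠ 0 := by
      by_contra! h; exact hv0 (funext h)
    apply hT0
    have : (Matrix.single i0 j (v j)⁻¹ : Matrix n n F).mulVec v = Pi.single i0 1 := by
      simp [Matrix.single_mulVec, hj]; rfl
    rw [← this, hT, hv, Matrix.mulVec_zero]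
  let g := LinearMap.toMatrix' T
  have hgu : IsUnit g := by
    rw [← Matrix.mulVec_injective_iff_isUnit]
    intro v w hvw
    apply hinj
    simpa [g, LinearMap.toMatrix'_mulVec] using hvw
  obtain ⟨U, hU⟩ := hgu
  refine ⟨g, ↑(U⁻¹), by rw [← hU]; simp, by rw [← hU]; simp, fun M => ?_⟩
  have : θ M * g = g * M := by
    apply Matrix.ext_of_mulVec_single
    intro j
    rw [← Matrix.mulVec_mulVec, ← Matrix.mulVec_mulVec]
    simp only [g, LinearMap.toMatrix'_mulVec]
    rw [hT]
  rw [← this, ← hU, mul_assoc]; simp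

theorem trace_conj_matrix {F : Type*} [Field F] {n : Type*} [Fintype n] [DecidableEq n]
    (g g' : Matrix n n F) :
    LinearMap.trace F (Matrix n n F) (LinearMap.mulLeft F g ∘ₗ LinearMap.mulRight F g') =
      g.trace * g'.trace := by
  rw [LinearMap.trace_eq_matrix_trace F (Matrix.stdBasis F n n), Matrix.trace]
  simp only [Matrix.diag, LinearMap.toMatrix_apply, Fintype.sum_prod_type]
  have hr : ∀ (X : Matrix n n F) (i j : n), (Matrix.stdBasis F n n).repr X (i, j) = X i j := by
    intro X i j
    simp [Matrix.stdBasis]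
  simp only [hr, Matrix.stdBasis_eq_single, LinearMap.comp_apply, LinearMap.mulLeft_apply,
    LinearMap.mulRight_apply, Matrix.trace, Matrix.diag, Finset.sum_mul_sum]
  refine Finset.sum_congr rfl fun i _ => Finset.sum_congr rfl fun j _ => ?_
  rw [← mul_assoc, Matrix.mul_apply, Finset.sum_eq_single j]
  · simp
  · intro k _ hk
    have : (g * Matrix.single i j (1 : F)) i k = 0 := by
      simp [Matrix.mul_apply, hk.symm]
    exact mul_eq_zero_of_left this _
  · simp

theorem trace_swap {F : Type*} [Field F] {A : Type*} [AddCommGroup A] [Module F A]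
    [FiniteDimensional F A] :
    LinearMap.trace F (A ⊗[F] A) (TensorProduct.comm F A A).toLinearMap = Module.finrank F A := by
  let b := Module.finBasis F A
  rw [LinearMap.trace_eq_matrix_trace F (b.tensorProduct b), Matrix.trace]
  simp only [Matrix.diag, LinearMap.toMatrix_apply, Fintype.sum_prod_type]
  simp [Finsupp.single_apply]


/-- Eigenspaces of an involution. -/
theorem inv_finrank {F : Type*} [Field F] (h2 : (2 : F) ≠ 0) {V : Type*} [AddCommGroup V]
    [Module F V] [FiniteDimensional F V] (T : V →ₗ[F] V) (hT : ∀ v, T (T v) = v) :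
    Module.finrank F (LinearMap.ker (T - LinearMap.id)) +
      Module.finrank F (LinearMap.ker (T + LinearMap.id)) = Module.finrank F V := by
  have hr : LinearMap.range (T - LinearMap.id) = LinearMap.ker (T + LinearMap.id) := by
    ext v
    constructor
    · rintro ⟨w, rfl⟩
      simp [hT]
    · intro hv
      have hv : T v = -v := by simpa [add_eq_zero_iff_eq_neg] using hv
      refine ⟨(-2⁻¹ : F) • v, ?_⟩
      simp only [LinearMap.sub_apply, map_smul, hv, LinearMap.id_apply]
      rw [neg_sub_left, ← two_smul F v, smul_neg, neg_smul, neg_neg, smul_smul,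
        inv_mul_cancel₀ h2, one_smul]
  rw [← hr, add_comm]
  exact LinearMap.finrank_range_add_finrank_ker _

/-- The involution. -/
theorem exists_involution {F : Type*} [Field F] (h2 : (2 : F) ≠ 0) {A : Type*} [DivisionRing A]
    [Algebra F A] (hdim : Module.finrank F A = 16) (hcomm : ∃ x y : A, x * y ≠ y * x)
    (e : A ⊗[F] A ≃ₐ[F] Matrix (Fin 16) (Fin 16) F) :
    ∃ σ : A →ₗ[F] A, (∀ x, σ (σ x) = x) ∧ (∀ x y, σ (x * y) = σ y * σ x) ∧
      Module.finrank F (LinearMap.ker (σ - LinearMap.id)) < 8 := by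
  have hfin : FiniteDimensional F A := Module.finite_of_finrank_pos (by omega)
  obtain ⟨g, g', hgg, hgg', hg⟩ := matrix_skolem
    ((e.symm.trans (Algebra.TensorProduct.comm F A A)).trans e)
  have hsw : ∀ t, e (Algebra.TensorProduct.comm F A A t) = g * e t * g' := by
    intro t
    simpa using hg (e t)
  -- trace
  have htr : g.trace * g'.trace = 16 := by
    rw [← trace_conj_matrix]
    have : (LinearMap.mulLeft F g ∘ₗ LinearMap.mulRight F g') =
        e.toLinearEquiv.conj (TensorProduct.comm F A A).toLinearMap := by
      ext1 M
      have := hg M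
      simp only [LinearMap.comp_apply, LinearMap.mulLeft_apply, LinearMap.mulRight_apply,
        ← mul_assoc, ← this]
      rfl
    rw [this, LinearMap.trace_conj', trace_swap, hdim]
    norm_num
  -- g*g central
  have hcen : ∀ M, g * g * M = M * (g * g) := by
    intro M
    obtain ⟨t, rfl⟩ := e.surjective M
    have h1 := hsw (Algebra.TensorProduct.comm F A A t)
    have h3 : Algebra.TensorProduct.comm F A A (Algebra.TensorProduct.comm F A A t) = t := by
      exact (TensorProduct.comm F A A).symm_apply_apply t
    rw [h3, hsw] at h1
    conv_rhs => rw [h1]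
    calc g * g * e t = g * g * e t * (g' * (g' * g) * g) := by rw [hgg', mul_one, hgg', mul_one]
      _ = _ := by simp only [mul_assoc]
  obtain ⟨c, hc⟩ : ∃ c : F, g * g = algebraMap F _ c := by
    have : g * g ∈ Subalgebra.center F (Matrix (Fin 16) (Fin 16) F) := by
      rw [Subalgebra.mem_center_iff]; intro M; exact (hcen M).symm
    exact Algebra.IsCentral.mem_center_iff F |>.1 this
  have hgc : g = c • g' := by
    calc g = g * (g * g') := by rw [hgg, mul_one]
      _ = g * g * g' := by rw [mul_assoc]
      _ = c • g' := by rw [hc, ← Algebra.smul_def]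
  have h16 : (16 : F) ≠ 0 := by
    have : (16 : F) = 2 ^ 4 := by norm_num
    rw [this]; exact pow_ne_zero _ h2
  have ht2 : g.trace * g.trace = 16 * c := by
    conv_lhs => rw [hgc, ← hgc]
    nth_rewrite 2 [hgc]
    rw [Matrix.trace_smul, ← htr, smul_eq_mul]; ring
  have htr0 : g.trace ≠ 0 := by
    intro h; rw [h, zero_mul] at htr; exact h16 htr.symm
  set t := g.trace with htdef
  -- normalise
  let H : Matrix (Fin 16) (Fin 16) F := (4 / t) • g
  have h4 : (4 : F) ≠ 0 := by
    have : (4 : F) = 2 ^ 2 := by norm_num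
    rw [this]; exact pow_ne_zero _ h2
  have hHH : H * H = 1 := by
    simp only [H, smul_mul_assoc, mul_smul_comm, smul_smul, hc]
    rw [Algebra.smul_def, ← map_mul]
    have : 4 / t * (4 / t) * c = 1 := by
      field_simp
      linear_combination -ht2
    rw [this, map_one]
  have hHtr : H.trace = 4 := by
    simp only [H, Matrix.trace_smul, ← htdef, smul_eq_mul]
    field_simp
  have hHsw : ∀ a b, H * e (a ⊗ₜ b) = e (b ⊗ₜ a) * H := by
    intro a b
    have := hsw (a ⊗ₜ b)
    rw [Algebra.TensorProduct.comm_tmul] at this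
    simp only [H, mul_smul_comm, smul_mul_assoc, this]
    rw [mul_assoc, hgg', mul_one]
  clear_value H
  clear hsw hg htr hcen hc hgc ht2 htr0 hgg hgg'
  -- eigenspaces of T
  let T := Matrix.toLin' H
  have hTT : ∀ v, T (T v) = v := by
    intro v; simp [T, hHH]
  have hTtr : LinearMap.trace F _ T = 4 := by
    rw [Matrix.trace_toLin'_eq, hHtr]
  -- there is a sign with small nonzero eigenspace
  have key : ∃ ε : F, ε * ε = 1 ∧ Module.finrank F (LinearMap.ker (T - ε • LinearMap.id)) < 8 ∧
      0 < Module.finrank F (LinearMap.ker (T - ε • LinearMap.id)) := by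
    have hsum := inv_finrank h2 T hTT
    rw [Module.finrank_fin_fun] at hsum
    have hproj : LinearMap.IsProj (LinearMap.ker (T - LinearMap.id))
        ((2⁻¹ : F) • (LinearMap.id + T)) := by
      constructor
      · intro x
        simp [hTT, smul_add, add_comm]
      · intro x hx
        have hx : T x = x := by simpa [sub_eq_zero] using hx
        simp only [LinearMap.smul_apply, LinearMap.add_apply, LinearMap.id_apply, hx]
        rw [← two_smul F x, smul_smul, inv_mul_cancel₀ h2, one_smul]
    have htrp := hproj.trace
    rw [map_smul, map_add, hTtr, LinearMap.trace_id, Module.finrank_fin_fun, smul_eq_mul] at htrp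
    have hne8 : Module.finrank F (LinearMap.ker (T - LinearMap.id)) ≠ 8 := by
      intro h
      rw [h] at htrp
      apply h4
      field_simp at htrp
      push_cast at htrp
      linear_combination htrp
    have hnz : ∀ ε : F, ε * ε = 1 →
        0 < Module.finrank F (LinearMap.ker (T - ε • LinearMap.id)) := by
      intro ε hε
      by_contra h0
      have hbot : LinearMap.ker (T - ε • LinearMap.id) = ⊥ :=
        Submodule.finrank_eq_zero.1 (by omega)
      rw [LinearMap.ker_eq_bot'] at hbot
      have hT' : ∀ v, T v = -ε • v := by
        intro v
        have := hbot (T v + ε • v) (by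
          change T (T v + ε • v) - ε • (T v + ε • v) = 0
          rw [map_add, hTT, map_smul, smul_add, smul_smul, hε, one_smul]
          abel)
        rw [neg_smul]
        exact eq_neg_of_add_eq_zero_left this
      have hH : H = -ε • (1 : Matrix (Fin 16) (Fin 16) F) := by
        apply Matrix.ext_of_mulVec_single
        intro i
        rw [Matrix.smul_mulVec, Matrix.one_mulVec]
        exact hT' _
      have hε0 : -ε ≠ 0 := by
        intro h
        rw [neg_eq_zero] at h
        simp [h] at hε
      have hab : ∀ a b : A, e (a ⊗ₜ b) = e (b ⊗ₜ a) := by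
        intro a b
        have := hHsw a b
        rw [hH, smul_mul_assoc, mul_smul_comm, one_mul, mul_one] at this
        exact smul_right_injective _ hε0 this
      obtain ⟨x, y, hxy⟩ := hcomm
      apply hxy
      have h1 : e ((x * y) ⊗ₜ 1) = e ((y * x) ⊗ₜ 1) := by
        calc e ((x * y) ⊗ₜ 1) = e (x ⊗ₜ 1) * e (y ⊗ₜ 1) := by
              rw [← map_mul, Algebra.TensorProduct.tmul_mul_tmul, one_mul]
          _ = e (1 ⊗ₜ x) * e (y ⊗ₜ 1) := by rw [hab x 1]
          _ = e (y ⊗ₜ 1) * e (1 ⊗ₜ x) := by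
              rw [← map_mul, ← map_mul]; simp
          _ = e (y ⊗ₜ 1) * e (x ⊗ₜ 1) := by rw [hab x 1]
          _ = _ := by rw [← map_mul, Algebra.TensorProduct.tmul_mul_tmul, one_mul]
      exact Algebra.TensorProduct.includeLeft_injective (S := F) (R := F) (A := A) (B := A)
        (algebraMap F A).injective (e.injective h1)
    have hp1 : LinearMap.ker (T - (1 : F) • LinearMap.id) = LinearMap.ker (T - LinearMap.id) := by
      rw [one_smul]
    have hm1 : LinearMap.ker (T - (-1 : F) • LinearMap.id) = LinearMap.ker (T + LinearMap.id) := by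
      congr 1
      refine LinearMap.ext fun v => ?_
      change T v - (-1 : F) • v = T v + v
      rw [neg_smul, one_smul, sub_neg_eq_add]
    by_cases hlt : Module.finrank F (LinearMap.ker (T - LinearMap.id)) < 8
    · exact ⟨1, by ring, by rw [hp1]; exact hlt, hnz 1 (by ring)⟩
    · exact ⟨-1, by ring, by rw [hm1]; omega, hnz (-1) (by ring)⟩
  obtain ⟨ε, hε, hlt, hpos⟩ := key
  obtain ⟨⟨v, hv⟩, hv0⟩ := Module.finrank_pos_iff_exists_ne_zero.1 hpos
  have hv0 : v ≠ 0 := by simpa using hv0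
  have hTv : T v = ε • v := by
    simpa [sub_eq_zero] using hv
  -- the map L
  let L : A →ₗ[F] (Fin 16 → F) :=
    { toFun := fun a => (e (a ⊗ₜ 1)).mulVec v
      map_add' := fun a b => by rw [TensorProduct.add_tmul, map_add, Matrix.add_mulVec]
      map_smul' := fun c a => by
        rw [← TensorProduct.smul_tmul', map_smul, Matrix.smul_mulVec]; rfl }
  have hL : ∀ a, L a = (e (a ⊗ₜ 1)).mulVec v := fun _ => rfl
  have hLinj : Function.Injective L := by
    rw [← LinearMap.ker_eq_bot, LinearMap.ker_eq_bot']
    intro a ha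
    by_contra ha0
    apply hv0
    have : (e (a⁻¹ ⊗ₜ 1) * e (a ⊗ₜ 1)).mulVec v = v := by
      rw [← map_mul, Algebra.TensorProduct.tmul_mul_tmul, inv_mul_cancel₀ ha0, one_mul,
        ← Algebra.TensorProduct.one_def, map_one, Matrix.one_mulVec]
    rw [← this, ← Matrix.mulVec_mulVec, ← hL, ha, Matrix.mulVec_zero]
  let Le : A ≃ₗ[F] (Fin 16 → F) := LinearEquiv.ofInjectiveOfFinrankEq L hLinj (by simp [hdim])
  have hLe : ∀ a, Le a = L a := fun a => rfl
  let σ : A →ₗ[F] A := ε • (Le.symm.toLinearMap ∘ₗ T ∘ₗ Le.toLinearMap)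
  have hσ : ∀ a, L (σ a) = ε • T (L a) := by
    intro a
    rw [← hLe, ← hLe]
    simp [σ]
  have hR : ∀ a, (e (1 ⊗ₜ a)).mulVec v = L (σ a) := by
    intro a
    have h1 := congrArg (fun M => M.mulVec v) (hHsw a 1)
    simp only [← Matrix.mulVec_mulVec] at h1
    have h2 : H.mulVec v = ε • v := hTv
    rw [h2, Matrix.mulVec_smul] at h1
    rw [hσ]
    change _ = ε • H.mulVec ((e (a ⊗ₜ 1)).mulVec v)
    rw [h1, smul_smul, hε, one_smul]
  refine ⟨σ, ?_, ?_, ?_⟩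
  · intro x
    apply hLinj
    rw [hσ, hσ, map_smul, smul_smul, hε, one_smul, hTT]
  · intro x y
    apply hLinj
    rw [← hR, hL]
    have h1 : (1 : A) ⊗ₜ[F] (x * y) = (1 ⊗ₜ x) * (1 ⊗ₜ y) := by
      rw [Algebra.TensorProduct.tmul_mul_tmul, one_mul]
    have h2 : (σ y * σ x) ⊗ₜ[F] (1 : A) = (σ y ⊗ₜ 1) * (σ x ⊗ₜ 1) := by
      rw [Algebra.TensorProduct.tmul_mul_tmul, one_mul]
    rw [h1, h2, map_mul, map_mul, ← Matrix.mulVec_mulVec, ← Matrix.mulVec_mulVec, hR, hL, ← hL (σ x),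
      ← hR x, Matrix.mulVec_mulVec, Matrix.mulVec_mulVec, ← map_mul, ← map_mul]
    simp
  · refine lt_of_le_of_lt ?_ hlt
    have hm : ∀ x ∈ LinearMap.ker (σ - LinearMap.id), L x ∈ LinearMap.ker (T - ε • LinearMap.id) := by
      intro x hx
      have hx : σ x = x := by simpa [sub_eq_zero] using hx
      have := hσ x
      rw [hx] at this
      have h3 : T (L x) = ε • L x := by
        conv_rhs => rw [this, smul_smul, hε, one_smul]
      simp [h3]
    exact LinearMap.finrank_le_finrank_of_injective (f := L.restrict hm)
      (by intro x y hxy; apply Subtype.ext; apply hLinj; simpa using congrArg Subtype.val hxy)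


theorem finrank_le_of_maps {F V : Type*} [Field F] [AddCommGroup V] [Module F V]
    [FiniteDimensional F V] (P Q : Submodule F V) (f : V →ₗ[F] V) (hf : Function.Injective f)
    (h : ∀ x ∈ P, f x ∈ Q) : Module.finrank F P ≤ Module.finrank F Q :=
  LinearMap.finrank_le_finrank_of_injective (f := f.restrict h)
    (by intro x y hxy; apply Subtype.ext; apply hf; simpa using congrArg Subtype.val hxy)

theorem split_finrank {F : Type*} [Field F] (h2 : (2 : F) ≠ 0) {V : Type*} [AddCommGroup V]
    [Module F V] [FiniteDimensional F V] (P X Y : Submodule F V) (T : V →ₗ[F] V)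
    (hT : ∀ v, T (T v) = v) (hP : ∀ x ∈ P, T x ∈ P) (hX : ∀ x, x ∈ X ↔ T x = x)
    (hY : ∀ x, x ∈ Y ↔ T x = -x) :
    Module.finrank F P = Module.finrank F (P ⊓ X : Submodule F V) +
      Module.finrank F (P ⊓ Y : Submodule F V) := by
  rw [← Submodule.finrank_sup_add_finrank_inf_eq]
  have h1 : (P ⊓ X) ⊓ (P ⊓ Y) = ⊥ := by
    rw [eq_bot_iff]
    rintro x ⟨⟨_, hx⟩, _, hy⟩
    have hx := (hX x).1 hx
    have hy := (hY x).1 hy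
    rw [hx, ← add_eq_zero_iff_eq_neg, ← two_smul F x] at hy
    simpa [h2] using hy
  have h3 : (P ⊓ X) ⊔ (P ⊓ Y) = P := by
    apply le_antisymm (sup_le inf_le_left inf_le_left)
    intro x hx
    have e : x = (2⁻¹ : F) • (x + T x) + (2⁻¹ : F) • (x - T x) := by
      rw [← smul_add, add_add_sub_cancel, ← two_smul F x, smul_smul, inv_mul_cancel₀ h2, one_smul]
    rw [e]
    apply Submodule.add_mem_sup
    · refine ⟨P.smul_mem _ (P.add_mem hx (hP x hx)), (hX _).2 ?_⟩
      rw [map_smul, map_add, hT, add_comm]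
    · refine ⟨P.smul_mem _ (P.sub_mem hx (hP x hx)), (hY _).2 ?_⟩
      rw [map_smul, map_sub, hT, ← smul_neg, neg_sub]
  rw [h1, h3, finrank_bot, add_zero]

section
variable {F : Type*} [Field F] {A : Type*} [DivisionRing A] [Algebra F A]

/-- elements commuting with `i` -/
def Pl (F : Type*) [Field F] {A : Type*} [DivisionRing A] [Algebra F A] (i : A) : Submodule F A :=
  LinearMap.ker (LinearMap.mulLeft F i - LinearMap.mulRight F i)

/-- elements anticommuting with `i` -/
def Mi (F : Type*) [Field F] {A : Type*} [DivisionRing A] [Algebra F A] (i : A) : Submodule F A :=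
  LinearMap.ker (LinearMap.mulLeft F i + LinearMap.mulRight F i)

theorem mem_Pl {i x : A} : x ∈ Pl F i ↔ i * x = x * i := by
  simp [Pl, sub_eq_zero]

theorem mem_Mi {i x : A} : x ∈ Mi F i ↔ i * x = -(x * i) := by
  simp [Mi, add_eq_zero_iff_eq_neg]

/-- conjugation -/
def cj (F : Type*) [Field F] {A : Type*} [DivisionRing A] [Algebra F A] (i : A) : A →ₗ[F] A :=
  LinearMap.mulLeft F i ∘ₗ LinearMap.mulRight F i⁻¹

theorem cj_apply (i x : A) : cj F i x = i * x * i⁻¹ := by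
  simp [cj, mul_assoc]

theorem mem_Pl_cj {i x : A} (hi : i ≠ 0) : x ∈ Pl F i ↔ cj F i x = x := by
  rw [mem_Pl, cj_apply, mul_inv_eq_iff_eq_mul₀ hi]

theorem mem_Mi_cj {i x : A} (hi : i ≠ 0) : x ∈ Mi F i ↔ cj F i x = -x := by
  rw [mem_Mi, cj_apply, mul_inv_eq_iff_eq_mul₀ hi, neg_mul]

theorem cj_cj {i : A} {a : F} (hi : i ≠ 0) (h : i * i = algebraMap F A a) (x : A) :
    cj F i (cj F i x) = x := by
  rw [cj_apply, cj_apply]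
  have : i * (i * x * i⁻¹) * i⁻¹ = (i * i) * x * (i * i)⁻¹ := by
    rw [mul_inv_rev]; simp only [mul_assoc]
  rw [this, h, Algebra.commutes, mul_assoc, ← h, mul_inv_cancel₀ (mul_ne_zero hi hi), mul_one]

theorem split_cj [FiniteDimensional F A] (h2 : (2 : F) ≠ 0) {i : A} {a : F} (hi : i ≠ 0)
    (h : i * i = algebraMap F A a) (S : Submodule F A) (hS : ∀ x ∈ S, cj F i x ∈ S) :
    Module.finrank F S = Module.finrank F (S ⊓ Pl F i : Submodule F A) +
      Module.finrank F (S ⊓ Mi F i : Submodule F A) :=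
  split_finrank h2 S _ _ (cj F i) (cj_cj hi h) hS (fun _ => mem_Pl_cj hi) (fun _ => mem_Mi_cj hi)

theorem mulLeft_inj {y : A} (hy : y ≠ 0) : Function.Injective (LinearMap.mulLeft F y) := by
  intro a b hab
  exact mul_left_cancel₀ hy (by simpa using hab)

theorem exists_Mi {i : A} {a : F} (h : i * i = algebraMap F A a)
    (hne : ∃ x, i * x ≠ x * i) : i ≠ 0 ∧ ∃ y ∈ Mi F i, y ≠ 0 := by
  obtain ⟨x, hx⟩ := hne
  have hi : i ≠ 0 := by rintro rfl; simp at hx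
  refine ⟨hi, x - cj F i x, ?_, ?_⟩
  · rw [mem_Mi_cj hi, map_sub, cj_cj hi h]; abel
  · intro h0
    exact hx (mem_Pl.1 ((mem_Pl_cj (F := F) hi).2 (sub_eq_zero.1 h0).symm))

theorem half_finrank [FiniteDimensional F A] (h2 : (2 : F) ≠ 0) {i : A} {a : F}
    (h : i * i = algebraMap F A a) (hne : ∃ x, i * x ≠ x * i) :
    2 * Module.finrank F (Pl F i) = Module.finrank F A ∧
    2 * Module.finrank F (Mi F i) = Module.finrank F A := by
  obtain ⟨hi, y, hy, hy0⟩ := exists_Mi h hne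
  have hs := split_cj h2 hi h ⊤ (fun _ _ => trivial)
  rw [top_inf_eq, top_inf_eq, finrank_top] at hs
  have hy := mem_Mi.1 hy
  have h1 : Module.finrank F (Pl F i) ≤ Module.finrank F (Mi F i) :=
    finrank_le_of_maps _ _ _ (mulLeft_inj hy0) (fun x hx => by
      have hx := mem_Pl.1 hx
      rw [mem_Mi, LinearMap.mulLeft_apply, ← mul_assoc, hy, neg_mul, mul_assoc, hx, mul_assoc])
  have h1' : Module.finrank F (Mi F i) ≤ Module.finrank F (Pl F i) :=
    finrank_le_of_maps _ _ _ (mulLeft_inj hy0) (fun x hx => by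
      have hx := mem_Mi.1 hx
      rw [mem_Pl, LinearMap.mulLeft_apply, ← mul_assoc, hy, neg_mul, mul_assoc, hx, mul_assoc,
        mul_neg, neg_neg])
  omega

theorem noncentral_of [Algebra.IsCentral F A] {x : A} (hx : ∀ c : F, x ≠ algebraMap F A c) :
    ∃ y, x * y ≠ y * x := by
  by_contra! h
  have : x ∈ Subalgebra.center F A := by
    rw [Subalgebra.mem_center_iff]; intro y; exact (h y).symm
  obtain ⟨c, hc⟩ := (Algebra.IsCentral.mem_center_iff F).1 this
  exact hx c hc

/-- A commuting-subspace dimension bound. -/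
theorem centralizer_bound (hdim : Module.finrank F A = 16)
    (e : A ⊗[F] A ≃ₐ[F] Matrix (Fin 16) (Fin 16) F)
    (σ : A →ₗ[F] A) (hσσ : ∀ x, σ (σ x) = x) (hσm : ∀ x y, σ (x * y) = σ y * σ x)
    (K : Subalgebra F A) (C : Submodule F A) (hC : ∀ k ∈ K, ∀ c ∈ C, k * c = c * k) :
    Module.finrank F K ∣ 16 ∧ Module.finrank F K * Module.finrank F C ≤ 16 := by
  have hfin : FiniteDimensional F A := Module.finite_of_finrank_pos (by omega)
  have hσ1 : σ 1 = 1 := by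
    have := hσm (σ 1) 1
    rw [mul_one, hσσ, mul_one] at this
    exact this.symm
  let σop : A →ₐ[F] Aᵐᵒᵖ := AlgHom.ofLinearMap
    ((MulOpposite.opLinearEquiv F).toLinearMap ∘ₗ σ) (by simp [hσ1]) (by simp [hσm])
  let Ψ : A ⊗[F] A →ₐ[F] Module.End F A :=
    (AlgHom.mulLeftRight F A).comp (Algebra.TensorProduct.map (AlgHom.id F A) σop)
  have hΨ : ∀ a b y, Ψ (a ⊗ₜ b) y = a * y * σ b := by
    intro a b y
    simp [Ψ, σop]
    exact Or.inl rfl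
  have hΨinj : Function.Injective Ψ := by
    have h1 : Function.Injective (Ψ.comp e.symm.toAlgHom) :=
      (Ψ.comp e.symm.toAlgHom).toRingHom.injective
    intro x y hxy
    apply e.injective
    apply h1
    simpa using hxy
  let _ : DivisionRing K := divisionRingOfFiniteDimensional F K
  have htower := Module.finrank_mul_finrank F K A
  rw [hdim] at htower
  refine ⟨⟨_, htower.symm⟩, ?_⟩
  have : Module.Finite K A := Module.Finite.of_restrictScalars_finite F K A
  let b := Module.finBasis K A
  let ι : C ⊗[F] A →ₗ[F] A ⊗[F] A := LinearMap.rTensor A C.subtype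
  have hι : Function.Injective ι :=
    Module.Flat.rTensor_preserves_injective_linearMap _ C.injective_subtype
  let Θ : C ⊗[F] A →ₗ[F] (Fin (Module.finrank K A) → A) :=
    LinearMap.pi (fun j => (LinearMap.applyₗ (b j)) ∘ₗ Ψ.toLinearMap ∘ₗ ι)
  have hΘ : ∀ t j, Θ t j = Ψ (ι t) (b j) := fun t j => rfl
  have hlin : ∀ t (k : K) (y : A), Ψ (ι t) (k • y) = k • Ψ (ι t) y := by
    intro t k y
    induction t with
    | zero => simp
    | add s t hs ht => simp only [map_add, LinearMap.add_apply, hs, ht, smul_add]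
    | tmul c a =>
      have : ι (c ⊗ₜ a) = (c : A) ⊗ₜ a := rfl
      rw [this, hΨ, hΨ]
      change (c : A) * ((k : A) * y) * σ a = (k : A) * (c * y * σ a)
      simp only [← mul_assoc]
      rw [hC k k.2 c c.2]
  have hΘinj : Function.Injective Θ := by
    intro t1 t2 h
    apply hι
    apply hΨinj
    refine LinearMap.ext fun y => ?_
    rw [← b.sum_repr y, map_sum, map_sum]
    simp only [hlin]
    have hb : ∀ j, Ψ (ι t1) (b j) = Ψ (ι t2) (b j) := fun j => by rw [← hΘ, ← hΘ, h]
    simp only [hb]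
  have := LinearMap.finrank_le_finrank_of_injective hΘinj
  rw [Module.finrank_tensorProduct, hdim, Module.finrank_pi_fintype] at this
  simp only [hdim, Finset.sum_const, Finset.card_univ, Fintype.card_fin, smul_eq_mul] at this
  nlinarith

theorem exists_quat_pair (h2 : (2 : F) ≠ 0) [Algebra.IsCentral F A]
    (hdim : Module.finrank F A = 16)
    (e : A ⊗[F] A ≃ₐ[F] Matrix (Fin 16) (Fin 16) F)
    (σ : A →ₗ[F] A) (hσσ : ∀ x, σ (σ x) = x) (hσm : ∀ x y, σ (x * y) = σ y * σ x)
    (hlt : Module.finrank F (LinearMap.ker (σ - LinearMap.id)) < 8) :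
    ∃ (a b : F) (i j : A), a ≠ 0 ∧ b ≠ 0 ∧ i * i = algebraMap F A a ∧ j * j = algebraMap F A b ∧
      i * j = -(j * i) := by
  have hfin : FiniteDimensional F A := Module.finite_of_finrank_pos (by omega)
  have h2A : ∀ x : A, x = -x → x = 0 := by
    intro x hx
    have : (2 : F) • x = 0 := by
      rw [two_smul]; exact add_eq_zero_iff_eq_neg.2 hx
    simpa [h2] using this
  have hσ1 : σ 1 = 1 := by
    have := hσm (σ 1) 1
    rw [mul_one, hσσ, mul_one] at this
    exact this.symm
  have hσF : ∀ c : F, σ (algebraMap F A c) = algebraMap F A c := by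
    intro c
    rw [Algebra.algebraMap_eq_smul_one, map_smul, hσ1]
  set Sym := LinearMap.ker (σ - LinearMap.id) with hSymdef
  let Sk := LinearMap.ker (σ + LinearMap.id)
  have mSym : ∀ x, x ∈ Sym ↔ σ x = x := by intro x; simp [Sym, sub_eq_zero]
  have mSk : ∀ x, x ∈ Sk ↔ σ x = -x := by intro x; simp [Sk, add_eq_zero_iff_eq_neg]
  have hsp : ∀ P : Submodule F A, (∀ x ∈ P, σ x ∈ P) → Module.finrank F P =
      Module.finrank F (P ⊓ Sym : Submodule F A) + Module.finrank F (P ⊓ Sk : Submodule F A) :=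
    fun P hP => split_finrank h2 P Sym Sk σ hσσ hP mSym mSk
  have htot : Module.finrank F Sym + Module.finrank F Sk = 16 := by
    have := hsp ⊤ (fun _ _ => trivial)
    rw [top_inf_eq, top_inf_eq, finrank_top, hdim] at this
    exact this.symm
  -- stability
  have stP : ∀ i, (σ i = i ∨ σ i = -i) → ∀ x ∈ Pl F i, σ x ∈ Pl F i := by
    intro i hi x hx
    rw [mem_Pl] at hx ⊢
    have := congrArg σ hx
    rw [hσm, hσm] at this
    rcases hi with hi | hi <;> rw [hi] at this
    · exact this.symm
    · rw [neg_mul, mul_neg] at this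
      exact (neg_injective this).symm
  have stM : ∀ i, (σ i = i ∨ σ i = -i) → ∀ x ∈ Mi F i, σ x ∈ Mi F i := by
    intro i hi x hx
    rw [mem_Mi] at hx ⊢
    have := congrArg σ hx
    rw [map_neg, hσm, hσm] at this
    rcases hi with hi | hi <;> rw [hi] at this
    · rw [this, neg_neg]
    · rw [neg_mul, mul_neg, neg_neg] at this
      exact this.symm
  -- noncentral symmetric element
  obtain ⟨x, hxS, hxF⟩ : ∃ x, σ x = x ∧ ∀ c : F, x ≠ algebraMap F A c := by
    by_contra! hcon
    have hSym1 : Module.finrank F Sym ≤ 1 := by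
      apply finrank_le_one (⟨1, (mSym 1).2 hσ1⟩ : Sym)
      rintro ⟨w, hw⟩
      obtain ⟨c, hc⟩ := hcon w ((mSym w).1 hw)
      refine ⟨c, Subtype.ext ?_⟩
      change c • (1 : A) = w
      rw [hc, Algebra.algebraMap_eq_smul_one]
    have hpos : 0 < Module.finrank F Sk := by omega
    obtain ⟨⟨s, hs⟩, hs0⟩ := Module.finrank_pos_iff_exists_ne_zero.1 hpos
    have hs0 : s ≠ 0 := by simpa using hs0
    have hs := (mSk s).1 hs
    obtain ⟨c, hc⟩ := hcon (s * s) (by rw [hσm, hs, neg_mul_neg])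
    have hsF : ∀ c : F, s ≠ algebraMap F A c := by
      rintro c rfl
      rw [hσF] at hs
      exact hs0 (h2A _ hs)
    have h8 := (half_finrank h2 hc (noncentral_of hsF)).1
    have hs8 := hsp (Pl F s) (stP s (Or.inr hs))
    have hle1 : Module.finrank F (Pl F s ⊓ Sym : Submodule F A) ≤ Module.finrank F Sym :=
      Submodule.finrank_mono inf_le_right
    have hle2 : Module.finrank F (Pl F s ⊓ Sk : Submodule F A) ≤
        Module.finrank F (Pl F s ⊓ Sym : Submodule F A) :=
      finrank_le_of_maps _ _ _ (mulLeft_inj hs0) (fun x hx => by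
        obtain ⟨hx1, hx2⟩ := hx
        have hx1 := mem_Pl.1 hx1
        have hx2 := (mSk x).1 hx2
        refine ⟨mem_Pl.2 ?_, (mSym _).2 ?_⟩
        · simp only [LinearMap.mulLeft_apply]
          rw [mul_assoc s x s, ← hx1]
        · simp only [LinearMap.mulLeft_apply]
          rw [hσm, hx2, hs, neg_mul_neg, hx1])
    omega
  -- commuting skew element
  obtain ⟨s, hs, hs0, hxs⟩ : ∃ s, σ s = -s ∧ s ≠ 0 ∧ x * s = s * x := by
    by_contra! hcon
    have : Module.finrank F Sk ≤ Module.finrank F Sym := by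
      have hm : ∀ y ∈ Sk, (LinearMap.mulLeft F x - LinearMap.mulRight F x) y ∈ Sym := by
        intro y hy
        have hy := (mSk y).1 hy
        rw [mSym]
        simp only [LinearMap.sub_apply, LinearMap.mulLeft_apply, LinearMap.mulRight_apply]
        rw [map_sub, hσm, hσm, hy, hxS, neg_mul, mul_neg]
        abel
      refine LinearMap.finrank_le_finrank_of_injective
        (f := (LinearMap.mulLeft F x - LinearMap.mulRight F x).restrict hm) ?_
      refine (injective_iff_map_eq_zero _).2 ?_
      rintro ⟨y, hy⟩ h0
      have h0 := congrArg Subtype.val h0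
      have h0 : x * y = y * x := by simpa [sub_eq_zero] using h0
      by_contra hne
      exact hcon y ((mSk y).1 hy) (by simpa using hne) h0
    omega
  -- x is quadratic
  obtain ⟨t, n, htn⟩ : ∃ t n : F, x * x = t • x + algebraMap F A n := by
    let K := Algebra.adjoin F {x}
    have hxK : x ∈ K := Algebra.subset_adjoin rfl
    have hKcomm : ∀ k ∈ K, ∀ z, x * z = z * x → k * z = z * k := by
      intro k hk z hz
      induction hk using Algebra.adjoin_induction with
      | mem y hy => rw [Set.mem_singleton_iff.1 hy, hz]
      | algebraMap r => exact Algebra.commutes r z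
      | add a b _ _ ha hb => rw [add_mul, mul_add, ha, hb]
      | mul a b _ _ ha hb => rw [mul_assoc, hb, ← mul_assoc, ha, mul_assoc]
    have hKsym : ∀ k ∈ K, σ k = k := by
      intro k hk
      induction hk using Algebra.adjoin_induction with
      | mem y hy => rw [Set.mem_singleton_iff.1 hy, hxS]
      | algebraMap r => exact hσF r
      | add a b _ _ ha hb => rw [map_add, ha, hb]
      | mul a b haK hbK ha hb =>
        rw [hσm, ha, hb]
        exact hKcomm b hbK a (hKcomm a haK x rfl).symm
    obtain ⟨hdvd, hle⟩ := centralizer_bound hdim e σ hσσ hσm K (Pl F x)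
      (fun k hk c hc => hKcomm k hk c (mem_Pl.1 hc))
    have hlt' : Module.finrank F K < Module.finrank F (Pl F x) := by
      have hKP : Subalgebra.toSubmodule K < Pl F x := by
        refine lt_of_le_of_ne (fun k hk => mem_Pl.2 (hKcomm k hk x rfl).symm) ?_
        intro heq
        have : s ∈ Subalgebra.toSubmodule K := by rw [heq]; exact mem_Pl.2 hxs
        have := hKsym s this
        rw [hs] at this
        exact hs0 (h2A s this.symm)
      exact Submodule.finrank_lt_finrank_of_lt hKP
    have hd : Module.finrank F K < 4 := by nlinarith
    have hd2 : Module.finrank F K ≤ 2 := by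
      interval_cases hh : Module.finrank F K <;> omega
    -- dependence
    let w : Fin 3 → K := ![1, ⟨x, hxK⟩, ⟨x, hxK⟩ * ⟨x, hxK⟩]
    have hdep : ¬ LinearIndependent F w := by
      intro h
      have := h.fintype_card_le_finrank
      simp at this
      omega
    rw [Fintype.not_linearIndependent_iff] at hdep
    obtain ⟨g, hg, k, hk⟩ := hdep
    have hg := congrArg Subtype.val hg
    simp only [Fin.sum_univ_three, w] at hg
    have hg : g 0 • (1 : A) + g 1 • x + g 2 • (x * x) = 0 := by simpa using hg
    by_cases hg2 : g 2 = 0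
    · exfalso
      rw [hg2, zero_smul, add_zero] at hg
      by_cases hg1 : g 1 = 0
      · rw [hg1, zero_smul, add_zero] at hg
        have hg0 : g 0 = 0 := by simpa using hg
        apply hk
        fin_cases k <;> simp [hg0, hg1, hg2]
      · apply hxF (-(g 1)⁻¹ * g 0)
        rw [Algebra.algebraMap_eq_smul_one, mul_smul, neg_smul, eq_neg_of_add_eq_zero_left hg,
          smul_neg, neg_neg, smul_smul, inv_mul_cancel₀ hg1, one_smul]
    · refine ⟨-(g 2)⁻¹ * g 1, -(g 2)⁻¹ * g 0, ?_⟩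
      rw [Algebra.algebraMap_eq_smul_one, mul_smul, mul_smul, ← smul_add, add_comm (g 1 • x),
        eq_neg_of_add_eq_zero_left hg, smul_neg, neg_smul, neg_neg, smul_smul,
        inv_mul_cancel₀ hg2, one_smul]
  -- complete the square
  obtain ⟨i, a, hiS, hiF, hia⟩ : ∃ (i : A) (a : F), σ i = i ∧ (∀ c : F, i ≠ algebraMap F A c) ∧
      i * i = algebraMap F A a := by
    refine ⟨x - algebraMap F A (t / 2), n + (t / 2) ^ 2, ?_, ?_, ?_⟩
    · rw [map_sub, hxS, hσF]
    · intro c hc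
      apply hxF (c + t / 2)
      rw [map_add, ← hc, sub_add_cancel]
    · rw [sub_mul, mul_sub, mul_sub, htn, ← Algebra.commutes (t / 2) x, ← Algebra.smul_def,
        map_add, pow_two, map_mul]
      have hne : NeZero (2 : F) := ⟨h2⟩
      have : t • x = (t / 2) • x + (t / 2) • x := by rw [← add_smul, add_halves]
      rw [this]
      abel
  have hnc := noncentral_of hiF
  have hi0 : i ≠ 0 := by rintro rfl; exact hiF 0 (by simp)
  have ha0 : a ≠ 0 := by
    rintro rfl
    rw [map_zero] at hia
    exact hi0 (mul_self_eq_zero.1 hia)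
  obtain ⟨hP8, hM8⟩ := half_finrank h2 hia hnc
  have hMs := hsp (Mi F i) (stM i (Or.inl hiS))
  have hM1 : Module.finrank F (Mi F i ⊓ Sym : Submodule F A) ≤
      Module.finrank F (Mi F i ⊓ Sk : Submodule F A) :=
    finrank_le_of_maps _ _ _ (mulLeft_inj hi0) (fun x hx => by
      obtain ⟨hx1, hx2⟩ := hx
      have hx1 := mem_Mi.1 hx1
      have hx2 := (mSym x).1 hx2
      refine ⟨mem_Mi.2 ?_, (mSk _).2 ?_⟩ <;> simp only [LinearMap.mulLeft_apply]
      · rw [mul_assoc i x i, ← mul_neg, ← hx1]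
      · rw [hσm, hx2, hiS, hx1, neg_neg])
  have hM2 : Module.finrank F (Mi F i ⊓ Sk : Submodule F A) ≤
      Module.finrank F (Mi F i ⊓ Sym : Submodule F A) :=
    finrank_le_of_maps _ _ _ (mulLeft_inj hi0) (fun x hx => by
      obtain ⟨hx1, hx2⟩ := hx
      have hx1 := mem_Mi.1 hx1
      have hx2 := (mSk x).1 hx2
      refine ⟨mem_Mi.2 ?_, (mSym _).2 ?_⟩ <;> simp only [LinearMap.mulLeft_apply]
      · rw [mul_assoc i x i, ← mul_neg, ← hx1]
      · rw [hσm, hx2, hiS, hx1, neg_mul])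
  have hSs := split_cj h2 hi0 hia Sym (by
    intro x hx
    have hx := (mSym x).1 hx
    have hinv : i⁻¹ = a⁻¹ • i := by
      rw [inv_eq_iff_eq_inv, eq_comm]
      apply inv_eq_of_mul_eq_one_left
      rw [mul_smul_comm, hia, Algebra.smul_def, ← map_mul, inv_mul_cancel₀ ha0, map_one]
    rw [mSym, cj_apply, hinv, mul_smul_comm, map_smul, hσm, hσm, hx, hiS, mul_assoc])
  rw [inf_comm Sym (Mi F i)] at hSs
  have hSP : Module.finrank F (Sym ⊓ Pl F i : Submodule F A) < 4 := by omega
  obtain ⟨⟨j, hj⟩, hj0⟩ := Module.finrank_pos_iff_exists_ne_zero.1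
    (show 0 < Module.finrank F (Mi F i ⊓ Sym : Submodule F A) by omega)
  have hjn : j ≠ 0 := fun h => hj0 (Subtype.ext h)
  obtain ⟨hjM, hjS⟩ := hj
  have hjM := mem_Mi.1 hjM
  have hjS := (mSym j).1 hjS
  -- elements of Sym+ are in F + F i
  have hK : ∀ y, σ y = y → i * y = y * i → ∃ α β : F, y = algebraMap F A α + β • i := by
    intro y hy hyi
    let w : Fin 4 → (Sym ⊓ Pl F i : Submodule F A) :=
      ![⟨1, (mSym 1).2 hσ1, mem_Pl.2 (by rw [mul_one, one_mul])⟩,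
        ⟨i, (mSym i).2 hiS, mem_Pl.2 rfl⟩,
        ⟨y, (mSym y).2 hy, mem_Pl.2 hyi⟩,
        ⟨i * y, (mSym _).2 (by rw [hσm, hy, hiS, hyi]),
          mem_Pl.2 (by rw [mul_assoc i y i, ← hyi])⟩]
    have hdep : ¬ LinearIndependent F w := by
      intro h
      have := h.fintype_card_le_finrank
      simp only [Fintype.card_fin] at this
      omega
    rw [Fintype.not_linearIndependent_iff] at hdep
    obtain ⟨g, hg, k, hk⟩ := hdep
    have hg := congrArg Subtype.val hg
    simp only [Fin.sum_univ_four, w] at hg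
    have hg : g 0 • (1 : A) + g 1 • i + g 2 • y + g 3 • (i * y) = 0 := by simpa using hg
    have hli : ∀ α β : F, algebraMap F A α + β • i = 0 → α = 0 ∧ β = 0 := by
      intro α β h
      by_cases hβ : β = 0
      · subst hβ
        simpa using h
      · exfalso
        apply hiF (-β⁻¹ * α)
        rw [map_mul, eq_neg_of_add_eq_zero_left h, ← Algebra.smul_def, smul_neg, neg_smul, neg_neg,
          smul_smul, inv_mul_cancel₀ hβ, one_smul]
    -- norm
    set N := g 2 * g 2 - g 3 * g 3 * a with hN
    have hmul : (algebraMap F A (g 2) - g 3 • i) * (algebraMap F A (g 2) + g 3 • i)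
        = algebraMap F A N := by
      rw [sub_mul, mul_add, mul_add, ← map_mul, ← Algebra.commutes (g 2) (g 3 • i), smul_mul_smul_comm,
        hia, hN, map_sub, map_mul _ (g 3 * g 3) a, Algebra.smul_def (g 3 * g 3)]
      abel
    have hmul2 : (algebraMap F A (g 2) - g 3 • i) * (algebraMap F A (g 0) + g 1 • i)
        = algebraMap F A (g 2 * g 0 - g 3 * g 1 * a) + (g 2 * g 1 - g 3 * g 0) • i := by
      rw [sub_mul, mul_add, mul_add, ← map_mul, ← Algebra.commutes (g 0) (g 3 • i), smul_mul_smul_comm,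
        hia, map_sub, map_mul _ (g 3 * g 1) a, Algebra.smul_def (g 3 * g 1), sub_smul,
        ← Algebra.smul_def, ← Algebra.smul_def, smul_smul, smul_smul, mul_comm (g 0)]
      abel
    have hg' : (algebraMap F A (g 0) + g 1 • i) + (algebraMap F A (g 2) + g 3 • i) * y = 0 := by
      rw [← hg, add_mul, ← Algebra.smul_def, smul_mul_assoc, Algebra.algebraMap_eq_smul_one]
      abel
    have hg'' := congrArg (fun z => (algebraMap F A (g 2) - g 3 • i) * z) hg'
    simp only [mul_add _ (algebraMap F A (g 0) + g 1 • i), mul_zero] at hg''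
    rw [← mul_assoc, hmul, hmul2] at hg''
    by_cases hN0 : N = 0
    · exfalso
      rw [hN0, map_zero] at hmul
      have h23 : g 2 = 0 ∧ g 3 = 0 := by
        rcases mul_eq_zero.1 hmul with h | h
        · have := hli (g 2) (-(g 3)) (by rw [neg_smul, ← sub_eq_add_neg]; exact h)
          exact ⟨this.1, by simpa using this.2⟩
        · exact hli _ _ h
      have h01 := hli (g 0) (g 1) (by
        rw [h23.1, h23.2] at hg'
        simpa using hg')
      apply hk
      fin_cases k <;> simp [h23, h01]
    · refine ⟨-N⁻¹ * (g 2 * g 0 - g 3 * g 1 * a), -N⁻¹ * (g 2 * g 1 - g 3 * g 0), ?_⟩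
      have h3 := eq_neg_of_add_eq_zero_right hg''
      rw [← Algebra.smul_def] at h3
      have h4 : y = N⁻¹ • (N • y) := by rw [smul_smul, inv_mul_cancel₀ hN0, one_smul]
      rw [h4, h3, map_mul, ← Algebra.smul_def, mul_smul, ← smul_add, neg_smul, smul_neg]
  obtain ⟨α, β, hαβ⟩ := hK (j * j) (by rw [hσm, hjS])
    (by rw [← mul_assoc, hjM, neg_mul, mul_assoc, hjM, mul_neg, neg_neg, mul_assoc])
  have hβ : β = 0 := by
    have h1 : j * (j * j) = (j * j) * j := by rw [mul_assoc]
    rw [hαβ, mul_add, add_mul, ← Algebra.commutes α j, mul_smul_comm, smul_mul_assoc, hjM] at h1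
    have h3 := add_left_cancel h1
    rw [smul_neg] at h3
    have h4 := h2A _ h3
    rcases smul_eq_zero.1 h4 with h | h
    · exact h
    · exact absurd h (mul_ne_zero hjn hi0)
  rw [hβ, zero_smul, add_zero] at hαβ
  refine ⟨a, α, i, j, ha0, ?_, hia, hαβ, hjM⟩
  rintro rfl
  rw [map_zero] at hαβ
  exact hjn (mul_self_eq_zero.1 hαβ)

end


section quat
variable {F : Type*} [Field F]

theorem mulLeftRight_surj (h2 : (2 : F) ≠ 0) {a b : F} (ha : a ≠ 0) (hb : b ≠ 0) :
    Function.Surjective (AlgHom.mulLeftRight F ℍ[F,a,b]) := by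
  let W := (AlgHom.mulLeftRight F ℍ[F,a,b]).range
  have h4 : (4 : F) ≠ 0 := by
    have : (4 : F) = 2 * 2 := by norm_num
    rw [this]; exact mul_ne_zero h2 h2
  have hL : ∀ p q : ℍ[F,a,b], LinearMap.mulLeft F p ∘ₗ LinearMap.mulRight F q ∈ W := by
    intro p q
    refine ⟨p ⊗ₜ MulOpposite.op q, ?_⟩
    ext x : 1
    simp [mul_assoc]
  let i : ℍ[F,a,b] := ⟨0,1,0,0⟩
  let j : ℍ[F,a,b] := ⟨0,0,1,0⟩
  let k : ℍ[F,a,b] := ⟨0,0,0,1⟩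
  let P : Module.End F ℍ[F,a,b] := (4⁻¹ : F) • (LinearMap.mulLeft F 1 ∘ₗ LinearMap.mulRight F 1
    + LinearMap.mulLeft F i ∘ₗ LinearMap.mulRight F (a⁻¹ • i)
    + LinearMap.mulLeft F j ∘ₗ LinearMap.mulRight F (b⁻¹ • j)
    + LinearMap.mulLeft F k ∘ₗ LinearMap.mulRight F (-(a⁻¹ * b⁻¹) • k))
  have hPW : P ∈ W := W.smul_mem (W.add_mem (W.add_mem (W.add_mem (hL _ _) (hL _ _)) (hL _ _)) (hL _ _)) _
  have hP : ∀ q, P q = algebraMap F ℍ[F,a,b] q.re := by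
    intro q
    simp only [P, i, j, k]
    ext <;> simp <;> field_simp <;> ring
  intro f
  change f ∈ W
  have hf : f = LinearMap.mulLeft F (f 1) ∘ₗ LinearMap.mulRight F 1 * P * (LinearMap.mulLeft F 1 ∘ₗ LinearMap.mulRight F 1)
    + LinearMap.mulLeft F (f i) ∘ₗ LinearMap.mulRight F 1 * P * (LinearMap.mulLeft F 1 ∘ₗ LinearMap.mulRight F (a⁻¹ • i))
    + LinearMap.mulLeft F (f j) ∘ₗ LinearMap.mulRight F 1 * P * (LinearMap.mulLeft F 1 ∘ₗ LinearMap.mulRight F (b⁻¹ • j))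
    + LinearMap.mulLeft F (f k) ∘ₗ LinearMap.mulRight F 1 * P * (LinearMap.mulLeft F 1 ∘ₗ LinearMap.mulRight F (-(a⁻¹ * b⁻¹) • k)) := by
    refine LinearMap.ext fun q => ?_
    have hq : q = q.re • (1 : ℍ[F,a,b]) + q.imI • i + q.imJ • j + q.imK • k := by
      simp only [i, j, k]
      ext <;> simp
    conv_lhs => rw [hq]
    simp only [map_add, map_smul, LinearMap.add_apply, Module.End.mul_apply, LinearMap.comp_apply,
      LinearMap.mulLeft_apply, LinearMap.mulRight_apply, hP, mul_one, one_mul]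
    rw [← Algebra.commutes, ← Algebra.commutes, ← Algebra.commutes, ← Algebra.commutes]
    simp only [← Algebra.smul_def]
    congr 1
    · congr 1
      · congr 1
        congr 1
        simp [i]; field_simp
      · congr 1
        simp [j]; field_simp
    · congr 1
      simp [k]
      field_simp
  rw [hf]
  exact W.add_mem (W.add_mem (W.add_mem 
    (W.mul_mem (W.mul_mem (hL _ _) hPW) (hL _ _))
    (W.mul_mem (W.mul_mem (hL _ _) hPW) (hL _ _)))
    (W.mul_mem (W.mul_mem (hL _ _) hPW) (hL _ _)))
    (W.mul_mem (W.mul_mem (hL _ _) hPW) (hL _ _))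

theorem quat_sq (h2 : (2 : F) ≠ 0) {a b : F} (ha : a ≠ 0) (hb : b ≠ 0) :
    Nonempty (ℍ[F,a,b] ⊗[F] ℍ[F,a,b] ≃ₐ[F] Matrix (Fin 4) (Fin 4) F) := by
  have hs := mulLeftRight_surj h2 ha hb
  have hfr := QuaternionAlgebra.finrank_eq_four (R := F) a 0 b
  have hbij : Function.Bijective (AlgHom.mulLeftRight F ℍ[F,a,b]) := by
    refine ⟨?_, hs⟩
    refine (LinearMap.injective_iff_surjective_of_finrank_eq_finrank
      (f := (AlgHom.mulLeftRight F ℍ[F,a,b]).toLinearMap) ?_).2 hs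
    rw [Module.finrank_tensorProduct, Module.finrank_linearMap]
    congr 1
    exact (MulOpposite.opLinearEquiv F).finrank_eq.symm
  exact ⟨(Algebra.TensorProduct.congr AlgEquiv.refl QuaternionAlgebra.starAe).trans
    ((AlgEquiv.ofBijective _ hbij).trans (algEquivMatrix (QuaternionAlgebra.basisOneIJK a 0 b)))⟩

theorem central_simple_of_sq {B : Type*} [Ring B] [Algebra F B] {n : Type*} [Fintype n]
    [DecidableEq n] [Nonempty n] (e : B ⊗[F] B ≃ₐ[F] Matrix n n F) :
    Algebra.IsCentral F B ∧ IsSimpleRing B := by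
  have hnt : Nontrivial B := by
    by_contra h
    rw [not_nontrivial_iff_subsingleton] at h
    have : Subsingleton (B ⊗[F] B) := inferInstance
    have := e.symm.injective.subsingleton
    exact not_subsingleton (Matrix n n F) this
  have hc : Algebra.IsCentral F (B ⊗[F] B) := by
    refine ⟨fun x hx => ?_⟩
    have h1 : e x ∈ Subalgebra.center F (Matrix n n F) := by
      rw [Subalgebra.mem_center_iff] at hx ⊢
      intro y
      apply e.symm.injective
      simpa using hx (e.symm y)
    obtain ⟨c, hc⟩ := (Algebra.IsCentral.mem_center_iff F).1 h1
    refine ⟨c, ?_⟩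
    apply e.injective
    change e (algebraMap F _ c) = e x
    rw [hc, AlgEquiv.commutes]
  refine ⟨Algebra.IsCentral.left_of_tensor_of_field F B B, ?_⟩
  refine isSimpleRing_iff_isTwoSided_imp.2 ⟨hnt, ?_⟩
  intro I hI
  by_cases htop : I = ⊤
  · exact Or.inr htop
  left
  have hq : Nontrivial (B ⧸ I) := Ideal.Quotient.nontrivial_iff.2 htop
  let φ : B ⊗[F] B →ₐ[F] (B ⧸ I) ⊗[F] B :=
    Algebra.TensorProduct.map (Ideal.Quotient.mkₐ F I) (AlgHom.id F B)
  have hnt2 : Nontrivial ((B ⧸ I) ⊗[F] B) :=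
    (Algebra.TensorProduct.includeLeft_injective (R := F) (S := F) (A := B ⧸ I) (B := B)
      (algebraMap F B).injective).nontrivial
  have hinj : Function.Injective (φ.comp e.symm.toAlgHom) :=
    (φ.comp e.symm.toAlgHom).toRingHom.injective
  rw [eq_bot_iff]
  intro x hx
  have h0 : φ (x ⊗ₜ 1) = 0 := by
    simp [φ, Ideal.Quotient.eq_zero_iff_mem.2 hx]
  have h1 : e (x ⊗ₜ 1) = 0 := by
    apply hinj
    simpa using h0
  have h3 : (x ⊗ₜ[F] (1 : B)) = 0 := by simpa using h1
  exact Algebra.TensorProduct.includeLeft_injective (R := F) (S := F) (A := B) (B := B)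
      (algebraMap F B).injective (by simpa using h3)

theorem part1 (h2 : (2 : F) ≠ 0) {a b z w : F} (ha : a ≠ 0) (hb : b ≠ 0) (hz : z ≠ 0) (hw : w ≠ 0) :
    Algebra.IsCentral F (ℍ[F, a, b] ⊗[F] ℍ[F, z, w]) ∧
      IsSimpleRing (ℍ[F, a, b] ⊗[F] ℍ[F, z, w]) ∧
      Module.finrank F (ℍ[F, a, b] ⊗[F] ℍ[F, z, w]) = 16 ∧
      Nonempty ((ℍ[F, a, b] ⊗[F] ℍ[F, z, w]) ⊗[F] (ℍ[F, a, b] ⊗[F] ℍ[F, z, w]) ≃ₐ[F]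
        Matrix (Fin 16) (Fin 16) F) := by
  obtain ⟨e1⟩ := quat_sq h2 ha hb
  obtain ⟨e2⟩ := quat_sq h2 hz hw
  let e : (ℍ[F, a, b] ⊗[F] ℍ[F, z, w]) ⊗[F] (ℍ[F, a, b] ⊗[F] ℍ[F, z, w]) ≃ₐ[F]
        Matrix (Fin 16) (Fin 16) F :=
    (Algebra.TensorProduct.tensorTensorTensorComm F F F F _ _ _ _).trans
      ((Algebra.TensorProduct.congr e1 e2).trans
        ((Matrix.kroneckerAlgEquiv (Fin 4) (Fin 4) F).trans
          (Matrix.reindexAlgEquiv F F (finProdFinEquiv))))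
  obtain ⟨h1, h3⟩ := central_simple_of_sq e
  refine ⟨h1, h3, ?_, ⟨e⟩⟩
  rw [Module.finrank_tensorProduct, QuaternionAlgebra.finrank_eq_four,
    QuaternionAlgebra.finrank_eq_four]

end quat

section final
variable {F : Type*} [Field F]

theorem exists_quat_hom (h2 : (2 : F) ≠ 0) {D : Type*} [Ring D] [Nontrivial D] [Algebra F D]
    {a b : F} (ha : a ≠ 0) (hb : b ≠ 0) {i j : D} (hi : i * i = algebraMap F D a)
    (hj : j * j = algebraMap F D b) (hij : i * j = -(j * i)) :
    ∃ φ : ℍ[F,a,b] →ₐ[F] D, Function.Injective φ ∧ φ ⟨0,1,0,0⟩ = i ∧ φ ⟨0,0,1,0⟩ = j ∧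
      ∀ q, φ q = algebraMap F D q.re + q.imI • i + q.imJ • j + q.imK • (i * j) := by
  let B : QuaternionAlgebra.Basis D a 0 b :=
    { i := i, j := j, k := i * j
      i_mul_i := by rw [hi, Algebra.algebraMap_eq_smul_one]; simp
      j_mul_j := by rw [hj, Algebra.algebraMap_eq_smul_one]
      i_mul_j := rfl
      j_mul_i := by rw [hij]; simp }
  obtain ⟨e⟩ := quat_sq h2 ha hb
  obtain ⟨-, hs⟩ := central_simple_of_sq e
  have hf : ∀ q, B.liftHom q =
      algebraMap F D q.re + q.imI • i + q.imJ • j + q.imK • (i * j) := fun q => rfl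
  exact ⟨B.liftHom, B.liftHom.toRingHom.injective, by simp [hf], by simp [hf], hf⟩

theorem quat_equiv (h2 : (2 : F) ≠ 0) {D : Type*} [Ring D] [Nontrivial D] [Algebra F D]
    {a b : F} (ha : a ≠ 0) (hb : b ≠ 0) {i j : D} (hi : i * i = algebraMap F D a)
    (hj : j * j = algebraMap F D b) (hij : i * j = -(j * i)) (hdim : Module.finrank F D = 4) :
    Nonempty (D ≃ₐ[F] ℍ[F,a,b]) := by
  obtain ⟨φ, hφ, -⟩ := exists_quat_hom h2 ha hb hi hj hij
  have hfin : FiniteDimensional F D := Module.finite_of_finrank_pos (by omega)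
  have hs : Function.Surjective φ.toLinearMap :=
    (LinearMap.injective_iff_surjective_of_finrank_eq_finrank
      (by rw [hdim, QuaternionAlgebra.finrank_eq_four])).1 hφ
  exact ⟨(AlgEquiv.ofBijective φ ⟨hφ, hs⟩).symm⟩

theorem matrix_two_equiv (h2 : (2 : F) ≠ 0) :
    Nonempty (Matrix (Fin 2) (Fin 2) F ≃ₐ[F] ℍ[F,(1 : F),(1 : F)]) := by
  refine quat_equiv h2 one_ne_zero one_ne_zero (i := !![1, 0; 0, -1]) (j := !![0, 1; 1, 0])
    ?_ ?_ ?_ ?_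
  · ext x y; fin_cases x <;> fin_cases y <;> simp
  · ext x y; fin_cases x <;> fin_cases y <;> simp
  · ext x y; fin_cases x <;> fin_cases y <;> simp
  · rw [Module.finrank_matrix]; simp

theorem quadratic_of_le_two {A : Type*} [DivisionRing A] [Algebra F A] [FiniteDimensional F A]
    (K : Subalgebra F A)
    (hd2 : Module.finrank F K ≤ 2) {x : A} (hxK : x ∈ K) (hxF : ∀ c : F, x ≠ algebraMap F A c) :
    ∃ t n : F, x * x = t • x + algebraMap F A n := by
  let w : Fin 3 → K := ![1, ⟨x, hxK⟩, ⟨x, hxK⟩ * ⟨x, hxK⟩]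
  have hdep : ¬ LinearIndependent F w := by
    intro h
    have := h.fintype_card_le_finrank
    simp at this
    omega
  rw [Fintype.not_linearIndependent_iff] at hdep
  obtain ⟨g, hg, k, hk⟩ := hdep
  have hg := congrArg Subtype.val hg
  simp only [Fin.sum_univ_three, w] at hg
  have hg : g 0 • (1 : A) + g 1 • x + g 2 • (x * x) = 0 := by simpa using hg
  by_cases hg2 : g 2 = 0
  · exfalso
    rw [hg2, zero_smul, add_zero] at hg
    by_cases hg1 : g 1 = 0
    · rw [hg1, zero_smul, add_zero] at hg
      have hg0 : g 0 = 0 := by simpa using hg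
      apply hk
      fin_cases k <;> simp [hg0, hg1, hg2]
    · apply hxF (-(g 1)⁻¹ * g 0)
      rw [Algebra.algebraMap_eq_smul_one, mul_smul, neg_smul, eq_neg_of_add_eq_zero_left hg,
        smul_neg, neg_neg, smul_smul, inv_mul_cancel₀ hg1, one_smul]
  · refine ⟨-(g 2)⁻¹ * g 1, -(g 2)⁻¹ * g 0, ?_⟩
    rw [Algebra.algebraMap_eq_smul_one, mul_smul, mul_smul, ← smul_add, add_comm (g 1 • x),
      eq_neg_of_add_eq_zero_left hg, smul_neg, neg_smul, neg_neg, smul_smul,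
      inv_mul_cancel₀ hg2, one_smul]

theorem exists_nonscalar {A : Type*} [DivisionRing A] [Algebra F A]
    (h : Module.finrank F A ≠ 1) : ∃ x : A, ∀ c : F, x ≠ algebraMap F A c := by
  by_contra! hh
  apply h
  rw [finrank_eq_one_iff_of_nonzero' (1 : A) one_ne_zero]
  intro w
  obtain ⟨c, hc⟩ := hh w
  exact ⟨c, by rw [hc, Algebra.algebraMap_eq_smul_one]⟩

theorem division_four (h2 : (2 : F) ≠ 0) {D : Type*} [DivisionRing D] [Algebra F D]
    [Algebra.IsCentral F D] (hdim : Module.finrank F D = 4) :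
    ∃ z w : F, z ≠ 0 ∧ w ≠ 0 ∧ Nonempty (D ≃ₐ[F] ℍ[F,z,w]) := by
  have hfin : FiniteDimensional F D := Module.finite_of_finrank_pos (by omega)
  obtain ⟨x, hxF⟩ := exists_nonscalar (F := F) (A := D) (by omega)
  let K := Algebra.adjoin F {x}
  have hxK : x ∈ K := Algebra.subset_adjoin rfl
  have hKx : Subalgebra.toSubmodule K ≤ Pl F x := by
    intro k hk0
    have hk : k ∈ Algebra.adjoin F {x} := hk0
    clear hk0
    rw [mem_Pl]
    induction hk using Algebra.adjoin_induction with
    | mem y hy => rw [Set.mem_singleton_iff.1 hy]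
    | algebraMap r => exact (Algebra.commutes r x).symm
    | add a b _ _ ha hb => rw [mul_add, ha, hb, add_mul]
    | mul a b haK hbK ha hb => rw [← mul_assoc, ha, mul_assoc, hb, mul_assoc]
  have hPlt : Module.finrank F (Pl F x) < 4 := by
    rw [← hdim]
    apply Submodule.finrank_lt
    intro h
    obtain ⟨y, hy⟩ := noncentral_of hxF
    exact hy (mem_Pl.1 (by rw [h]; trivial))
  have hK4 : Module.finrank F K < 4 :=
    lt_of_le_of_lt (Submodule.finrank_mono hKx) hPlt
  have hdvd : Module.finrank F K ∣ 4 := by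
    let _ : DivisionRing K := divisionRingOfFiniteDimensional F K
    have htower := Module.finrank_mul_finrank F K D
    rw [hdim] at htower
    exact ⟨_, htower.symm⟩
  have hK2 : Module.finrank F K ≤ 2 := by
    by_contra h
    have h3 : Module.finrank F K = 3 := by omega
    rw [h3] at hdvd
    omega
  obtain ⟨t, n, htn⟩ := quadratic_of_le_two K hK2 hxK hxF
  obtain ⟨i, a, hiF, hia⟩ : ∃ (i : D) (a : F), (∀ c : F, i ≠ algebraMap F D c) ∧
      i * i = algebraMap F D a := by
    refine ⟨x - algebraMap F D (t / 2), n + (t / 2) ^ 2, ?_, ?_⟩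
    · intro c hc
      apply hxF (c + t / 2)
      rw [map_add, ← hc, sub_add_cancel]
    · rw [sub_mul, mul_sub, mul_sub, htn, ← Algebra.commutes (t / 2) x, ← Algebra.smul_def,
        map_add, pow_two, map_mul]
      have hne : NeZero (2 : F) := ⟨h2⟩
      have : t • x = (t / 2) • x + (t / 2) • x := by rw [← add_smul, add_halves]
      rw [this]
      abel
  have hnc := noncentral_of hiF
  obtain ⟨hi0, j, hjM, hj0⟩ := exists_Mi hia hnc
  have hjM := mem_Mi.1 hjM
  have hP2 := (half_finrank h2 hia hnc).1
  have hle1 : Module.finrank F (Pl F i ⊓ Pl F j : Submodule F D) ≤ 1 := by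
    have hlt : (Pl F i ⊓ Pl F j : Submodule F D) < Pl F i := by
      refine lt_of_le_of_ne inf_le_left ?_
      intro heq
      have hii : i ∈ Pl F i := mem_Pl.2 rfl
      rw [← heq] at hii
      have h1 := mem_Pl.1 hii.2
      rw [hjM] at h1
      have h3 : (2 : F) • (j * i) = 0 := by
        rw [two_smul]; nth_rewrite 1 [h1]; simp
      rcases smul_eq_zero.1 h3 with h | h
      · exact h2 h
      · exact mul_ne_zero hj0 hi0 h
    have := Submodule.finrank_lt_finrank_of_lt hlt
    omega
  have hb : ∃ b : F, j * j = algebraMap F D b := by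
    have h1 : (1 : D) ∈ Pl F i ⊓ Pl F j := ⟨mem_Pl.2 (by simp), mem_Pl.2 (by simp)⟩
    have hjj : j * j ∈ Pl F i ⊓ Pl F j := ⟨mem_Pl.2 (by
      rw [← mul_assoc, hjM, neg_mul, mul_assoc, hjM, mul_neg, neg_neg, mul_assoc]),
      mem_Pl.2 (by rw [mul_assoc])⟩
    obtain ⟨⟨v, hv⟩, hvs⟩ := finrank_le_one_iff.1 hle1
    obtain ⟨c, hc⟩ := hvs ⟨1, h1⟩
    obtain ⟨d, hd⟩ := hvs ⟨_, hjj⟩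
    have hc : c • v = 1 := congrArg Subtype.val hc
    have hd : d • v = j * j := congrArg Subtype.val hd
    have hc0 : c ≠ 0 := by rintro rfl; simp at hc
    refine ⟨d * c⁻¹, ?_⟩
    rw [← hd, Algebra.algebraMap_eq_smul_one, ← hc, smul_smul, mul_assoc, inv_mul_cancel₀ hc0,
      mul_one]
  obtain ⟨b, hb⟩ := hb
  have ha0 : a ≠ 0 := by
    rintro rfl
    rw [map_zero] at hia
    exact hi0 (mul_self_eq_zero.1 hia)
  have hb0 : b ≠ 0 := by
    rintro rfl
    rw [map_zero] at hb
    exact hj0 (mul_self_eq_zero.1 hb)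
  exact ⟨a, b, ha0, hb0, quat_equiv h2 ha0 hb0 hia hb hjM hdim⟩

theorem division_sixteen (h2 : (2 : F) ≠ 0) {A : Type*} [DivisionRing A] [Algebra F A]
    [Algebra.IsCentral F A] (hdim : Module.finrank F A = 16) {a b : F} (ha : a ≠ 0) (hb : b ≠ 0)
    {i j : A} (hi : i * i = algebraMap F A a)
    (hj : j * j = algebraMap F A b) (hij : i * j = -(j * i)) :
    ∃ z w : F, z ≠ 0 ∧ w ≠ 0 ∧ Nonempty (A ≃ₐ[F] ℍ[F,a,b] ⊗[F] ℍ[F,z,w]) := by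
  have hfin : FiniteDimensional F A := Module.finite_of_finrank_pos (by omega)
  have hi0 : i ≠ 0 := by
    rintro rfl
    apply ha
    simpa using hi.symm
  have hj0 : j ≠ 0 := by
    rintro rfl
    apply hb
    simpa using hj.symm
  have hji : j * i = -(i * j) := by rw [hij, neg_neg]
  have hnc : ∃ x, i * x ≠ x * i := by
    refine ⟨j, fun h1 => ?_⟩
    rw [hij] at h1
    have h3 : (2 : F) • (j * i) = 0 := by
      rw [two_smul]; nth_rewrite 1 [← h1]; simp
    rcases smul_eq_zero.1 h3 with h | h
    · exact h2 h
    · exact mul_ne_zero hj0 hi0 h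
  let C : Subalgebra F A := Subalgebra.centralizer F {i, j}
  have hC : ∀ x, x ∈ C ↔ i * x = x * i ∧ j * x = x * j := by
    intro x
    simp [C, Subalgebra.mem_centralizer_iff]
  -- stability
  have hst : ∀ x ∈ Pl F i, cj F j x ∈ Pl F i := by
    intro x hx
    have hx := mem_Pl.1 hx
    rw [mem_Pl, cj_apply]
    have hjinv : j⁻¹ * i = -(i * j⁻¹) := by
      have : j⁻¹ * (j * i) * j⁻¹ = j⁻¹ * (-(i * j)) * j⁻¹ := by rw [hji]
      rw [inv_mul_cancel_left₀ hj0, mul_neg, neg_mul, mul_assoc, mul_assoc,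
        mul_inv_cancel₀ hj0, mul_one] at this
      rw [this, neg_neg]
    calc i * (j * x * j⁻¹) = (i * j) * x * j⁻¹ := by simp only [mul_assoc]
      _ = -(j * (i * x) * j⁻¹) := by rw [hij]; simp only [neg_mul, mul_assoc]
      _ = j * x * (-(i * j⁻¹)) := by rw [hx]; simp only [mul_neg, mul_assoc]
      _ = j * x * j⁻¹ * i := by rw [← hjinv]; simp only [mul_assoc]
  have hCfr : Module.finrank F C = 4 := by
    have h8 := (half_finrank h2 hi hnc).1
    have hs := split_cj h2 hj0 hj (Pl F i) hst
    have hCeq : Module.finrank F C = Module.finrank F (Pl F i ⊓ Pl F j : Submodule F A) := by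
      have : Subalgebra.toSubmodule C = Pl F i ⊓ Pl F j := by
        ext x
        rw [Subalgebra.mem_toSubmodule, hC, Submodule.mem_inf, mem_Pl, mem_Pl]
      rw [← this]
      rfl
    have hle : Module.finrank F (Pl F i ⊓ Pl F j : Submodule F A) ≤
        Module.finrank F (Pl F i ⊓ Mi F j : Submodule F A) := by
      refine finrank_le_of_maps _ _ _ (mulLeft_inj hi0) fun x hx => ?_
      have hx1 := mem_Pl.1 hx.1
      have hx2 := mem_Pl.1 hx.2
      refine ⟨mem_Pl.2 ?_, mem_Mi.2 ?_⟩
      · rw [LinearMap.mulLeft_apply, mul_assoc, hx1]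
      · rw [LinearMap.mulLeft_apply, ← mul_assoc, hji, neg_mul, mul_assoc, hx2, mul_assoc]
    have hge : Module.finrank F (Pl F i ⊓ Mi F j : Submodule F A) ≤
        Module.finrank F (Pl F i ⊓ Pl F j : Submodule F A) := by
      refine finrank_le_of_maps _ _ _ (mulLeft_inj hi0) fun x hx => ?_
      have hx1 := mem_Pl.1 hx.1
      have hx2 := mem_Mi.1 hx.2
      refine ⟨mem_Pl.2 ?_, mem_Pl.2 ?_⟩
      · rw [LinearMap.mulLeft_apply, mul_assoc, hx1]
      · rw [LinearMap.mulLeft_apply, ← mul_assoc, hji, neg_mul, mul_assoc, hx2, mul_neg, neg_neg,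
          mul_assoc]
    omega
  obtain ⟨φ, -, hφi, hφj, hφ⟩ := exists_quat_hom h2 ha hb hi hj hij
  have hcomm : ∀ (q : ℍ[F,a,b]) (c : C), Commute (φ q) (C.val c) := by
    intro q c
    obtain ⟨h1, h3⟩ := (hC c).1 c.2
    have h1 : Commute i (c : A) := h1
    have h3 : Commute j (c : A) := h3
    rw [hφ]
    exact (((Algebra.commute_algebraMap_left _ _).add_left (h1.smul_left _)).add_left
      (h3.smul_left _)).add_left ((h1.mul_left h3).smul_left _)
  let m : ℍ[F,a,b] ⊗[F] C →ₐ[F] A := Algebra.TensorProduct.lift φ C.val hcomm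
  let W := m.range
  have hWC : ∀ c ∈ C, c ∈ W := fun c hc => ⟨1 ⊗ₜ ⟨c, hc⟩, by simp [m]⟩
  have hWi : i ∈ W := ⟨(⟨0,1,0,0⟩ : ℍ[F,a,b]) ⊗ₜ 1, by simp [m, hφi]⟩
  have hWj : j ∈ W := ⟨(⟨0,0,1,0⟩ : ℍ[F,a,b]) ⊗ₜ 1, by simp [m, hφj]⟩
  have hdec : ∀ x y : A, x + y ∈ W → x - y ∈ W → x ∈ W := by
    intro x y h h'
    have e : x = (2⁻¹ : F) • ((x + y) + (x - y)) := by
      rw [add_add_sub_cancel, ← two_smul F x, smul_smul, inv_mul_cancel₀ h2, one_smul]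
    rw [e]
    exact W.smul_mem (W.add_mem h h') _
  have hmulW : ∀ (c : F) (v x : A), c ≠ 0 → v * v = algebraMap F A c → v ∈ W → v * x ∈ W →
      x ∈ W := by
    intro c v x hc hv hvW hvx
    have e : x = c⁻¹ • (v * (v * x)) := by
      rw [← mul_assoc, hv, ← Algebra.smul_def, smul_smul, inv_mul_cancel₀ hc, one_smul]
    rw [e]
    exact W.smul_mem (W.mul_mem hvW hvx) _
  have hPW : ∀ x ∈ Pl F i, x ∈ W := by
    intro x hx
    have hx' := hst x hx
    apply hdec x (cj F j x)
    · apply hWC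
      rw [hC]
      refine ⟨mem_Pl.1 ((Pl F i).add_mem hx hx'), mem_Pl.1 ((mem_Pl_cj (F := F) hj0).2 ?_)⟩
      rw [map_add, cj_cj hj0 hj, add_comm]
    · have h1 := mem_Pl.1 ((Pl F i).sub_mem hx hx')
      have h3 : j * (x - cj F j x) = -((x - cj F j x) * j) := mem_Mi.1 ((mem_Mi_cj (F := F) hj0).2
        (by rw [map_sub, cj_cj hj0 hj, neg_sub]))
      apply hmulW a i _ ha hi hWi
      apply hWC
      rw [hC]
      refine ⟨by rw [mul_assoc, h1], ?_⟩
      rw [← mul_assoc, hji, neg_mul, mul_assoc, h3, mul_neg, neg_neg, mul_assoc]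
  have hall : ∀ x : A, x ∈ W := by
    intro x
    apply hdec x (cj F i x)
    · apply hPW
      rw [mem_Pl_cj hi0, map_add, cj_cj hi0 hi, add_comm]
    · have h3 : i * (x - cj F i x) = -((x - cj F i x) * i) := mem_Mi.1 ((mem_Mi_cj (F := F) hi0).2
        (by rw [map_sub, cj_cj hi0 hi, neg_sub]))
      apply hmulW b j _ hb hj hWj
      apply hPW
      rw [mem_Pl, ← mul_assoc, hij, neg_mul, mul_assoc, h3, mul_neg, neg_neg, mul_assoc]
  have hsurj : Function.Surjective m := fun x => hall x
  have hinj : Function.Injective m :=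
    (LinearMap.injective_iff_surjective_of_finrank_eq_finrank (f := m.toLinearMap)
      (by rw [Module.finrank_tensorProduct, hdim, hCfr, QuaternionAlgebra.finrank_eq_four])).2 hsurj
  let em := AlgEquiv.ofBijective m ⟨hinj, hsurj⟩
  have hCcent : Algebra.IsCentral F C := by
    refine ⟨fun x hx => ?_⟩
    rw [Subalgebra.mem_center_iff] at hx
    have hxc : (x : A) ∈ Subalgebra.center F A := by
      rw [Subalgebra.mem_center_iff]
      intro y
      obtain ⟨t, rfl⟩ := hsurj y
      induction t with
      | zero => simp
      | add s t hs ht => rw [map_add, add_mul, mul_add, hs, ht]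
      | tmul q c =>
        have e1 : m (q ⊗ₜ c) = φ q * c := by simp [m]
        have e3 : (c : A) * x = x * c := congrArg Subtype.val (hx c)
        have e4 : φ q * x = x * φ q := hcomm q x
        rw [e1, mul_assoc, e3, ← mul_assoc, e4, mul_assoc]
    obtain ⟨c, hc⟩ := (Algebra.IsCentral.mem_center_iff F).1 hxc
    exact ⟨c, Subtype.ext hc.symm⟩
  obtain ⟨z, w, hz, hw, ⟨ec⟩⟩ : ∃ z w : F, z ≠ 0 ∧ w ≠ 0 ∧ Nonempty (C ≃ₐ[F] ℍ[F,z,w]) := by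
    let _ : DivisionRing C := divisionRingOfFiniteDimensional F C
    exact division_four h2 hCfr
  exact ⟨z, w, hz, hw, ⟨em.symm.trans (Algebra.TensorProduct.congr AlgEquiv.refl ec)⟩⟩

end final

section assembly
variable {F : Type*} [Field F]

theorem central_transfer {A B : Type*} [Ring A] [Ring B] [Algebra F A] [Algebra F B]
    (e : A ≃ₐ[F] B) [Algebra.IsCentral F A] : Algebra.IsCentral F B := by
  refine ⟨fun x hx => ?_⟩
  have h1 : e.symm x ∈ Subalgebra.center F A := by
    rw [Subalgebra.mem_center_iff] at hx ⊢
    intro y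
    apply e.injective
    simpa using hx (e y)
  obtain ⟨c, hc⟩ := (Algebra.IsCentral.mem_center_iff F).1 h1
  refine ⟨c, ?_⟩
  apply e.symm.injective
  change e.symm (algebraMap F _ c) = e.symm x
  rw [hc, AlgEquiv.commutes]

theorem division_case (h2 : (2 : F) ≠ 0) {A : Type*} [DivisionRing A] [Algebra F A]
    [Algebra.IsCentral F A] (hdim : Module.finrank F A = 16)
    (e : A ⊗[F] A ≃ₐ[F] Matrix (Fin 16) (Fin 16) F) :
    ∃ a b z w : F, a ≠ 0 ∧ b ≠ 0 ∧ z ≠ 0 ∧ w ≠ 0 ∧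
        Nonempty (A ≃ₐ[F] ℍ[F, a, b] ⊗[F] ℍ[F, z, w]) := by
  obtain ⟨x, hx⟩ := exists_nonscalar (F := F) (A := A) (by omega)
  obtain ⟨y, hy⟩ := noncentral_of hx
  obtain ⟨σ, h1, h3, h4⟩ := exists_involution h2 hdim ⟨x, y, hy⟩ e
  obtain ⟨a, b, i, j, ha, hb, hi, hj, hij⟩ := exists_quat_pair h2 hdim e σ h1 h3 h4
  obtain ⟨z, w, hz, hw, h⟩ := division_sixteen h2 hdim ha hb hi hj hij
  exact ⟨a, b, z, w, ha, hb, hz, hw, h⟩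

theorem part2 (h2 : (2 : F) ≠ 0) {A : Type*} [Ring A] [Algebra F A]
    [Algebra.IsCentral F A] [IsSimpleRing A] (hdim : Module.finrank F A = 16)
    (e : A ⊗[F] A ≃ₐ[F] Matrix (Fin 16) (Fin 16) F) :
    ∃ a b z w : F, a ≠ 0 ∧ b ≠ 0 ∧ z ≠ 0 ∧ w ≠ 0 ∧
        Nonempty (A ≃ₐ[F] ℍ[F, a, b] ⊗[F] ℍ[F, z, w]) := by
  have hfin : FiniteDimensional F A := Module.finite_of_finrank_pos (by omega)
  have hart : IsArtinianRing A := IsArtinianRing.of_finite F A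
  obtain ⟨n, hn, D, _, _, hDf, ⟨f⟩⟩ :=
    IsSimpleRing.exists_algEquiv_matrix_divisionRing_finite F A
  have hnd : n * n * Module.finrank F D = 16 := by
    rw [← hdim, f.toLinearEquiv.finrank_eq, Module.finrank_matrix]
    simp
  let f' : A ≃ₐ[F] D ⊗[F] Matrix (Fin n) (Fin n) F := f.trans (matrixEquivTensor (Fin n) F D)
  have hDc : Algebra.IsCentral F D := by
    have := central_transfer f'
    exact Algebra.IsCentral.left_of_tensor_of_field F D (Matrix (Fin n) (Fin n) F)
  have hD1 : 0 < Module.finrank F D := Module.finrank_pos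
  have hn4 : n ≤ 4 := by
    by_contra h
    have h5 : 5 ≤ n := by omega
    nlinarith
  obtain ⟨em⟩ := matrix_two_equiv h2
  have hn0 : n ≠ 0 := hn.out
  interval_cases n
  · exact absurd rfl hn0
  · have hsc : Function.Bijective (Matrix.scalarAlgHom (α := D) (Fin 1) F) := by
      refine ⟨fun x y hxy => ?_, fun M => ⟨M 0 0, ?_⟩⟩
      · simpa using congrFun (congrFun hxy 0) 0
      · ext x y
        fin_cases x
        fin_cases y
        simp
    have g : A ≃ₐ[F] D := f.trans (AlgEquiv.ofBijective _ hsc).symm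
    obtain ⟨a, b, z, w, ha, hb, hz, hw, ⟨k⟩⟩ := division_case h2 (A := D) (by omega)
      ((Algebra.TensorProduct.congr g.symm g.symm).trans e)
    exact ⟨a, b, z, w, ha, hb, hz, hw, ⟨g.trans k⟩⟩
  · obtain ⟨z, w, hz, hw, ⟨k⟩⟩ := division_four h2 (D := D) (by omega)
    exact ⟨z, w, 1, 1, hz, hw, one_ne_zero, one_ne_zero,
      ⟨f'.trans (Algebra.TensorProduct.congr k em)⟩⟩
  · omega
  · have hb : Function.Bijective (algebraMap F D) := by
      refine ⟨(algebraMap F D).injective, fun x => ?_⟩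
      obtain ⟨c, hc⟩ := (finrank_eq_one_iff_of_nonzero' (1 : D) one_ne_zero).1
        (show Module.finrank F D = 1 by omega) x
      exact ⟨c, by rw [← hc, Algebra.algebraMap_eq_smul_one]⟩
    let g : F ≃ₐ[F] D := AlgEquiv.ofBijective (Algebra.ofId F D) hb
    let s : Matrix (Fin 4) (Fin 4) F ≃ₐ[F] Matrix (Fin 2) (Fin 2) F ⊗[F] Matrix (Fin 2) (Fin 2) F :=
      (Matrix.reindexAlgEquiv F F (finProdFinEquiv (m := 2) (n := 2)).symm).trans
        (Matrix.kroneckerAlgEquiv (Fin 2) (Fin 2) F).symm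
    exact ⟨1, 1, 1, 1, one_ne_zero, one_ne_zero, one_ne_zero, one_ne_zero,
      ⟨f'.trans ((Algebra.TensorProduct.congr g.symm AlgEquiv.refl).trans
        ((Algebra.TensorProduct.lid F _).trans (s.trans (Algebra.TensorProduct.congr em em))))⟩⟩

end assembly

/-- Albert's theorem: over a field `F` of characteristic `≠ 2`, the tensor
products `(a,b)_F ⊗ (z,w)_F` for `(a, b, z, w) ∈ (F^×)⁴` are exactly (up to isomorphism)
the central simple `F`-algebras of degree 4 (dimension 16) and exponent dividing 2
(i.e. `A ⊗ A` split): every such tensor product is a central simple algebra of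
dimension 16 whose square is split, and conversely every central simple `F`-algebra of
degree 4 and exponent dividing 2 is isomorphic to a tensor product of two quaternion
algebras. -/
theorem stmt14 (F : Type*) [Field F] (hchar : ringChar F ≠ 2) :
    (∀ a b z w : F, a ≠ 0 → b ≠ 0 → z ≠ 0 → w ≠ 0 →
      Algebra.IsCentral F (ℍ[F, a, b] ⊗[F] ℍ[F, z, w]) ∧
      IsSimpleRing (ℍ[F, a, b] ⊗[F] ℍ[F, z, w]) ∧
      Module.finrank F (ℍ[F, a, b] ⊗[F] ℍ[F, z, w]) = 16 ∧
      Nonempty ((ℍ[F, a, b] ⊗[F] ℍ[F, z, w]) ⊗[F] (ℍ[F, a, b] ⊗[F] ℍ[F, z, w]) ≃ₐ[F]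
        Matrix (Fin 16) (Fin 16) F)) ∧
    (∀ (A : Type) (_ : Ring A) (_ : Algebra F A),
      Algebra.IsCentral F A → IsSimpleRing A → Module.finrank F A = 16 →
      Nonempty (A ⊗[F] A ≃ₐ[F] Matrix (Fin 16) (Fin 16) F) →
      ∃ a b z w : F, a ≠ 0 ∧ b ≠ 0 ∧ z ≠ 0 ∧ w ≠ 0 ∧
        Nonempty (A ≃ₐ[F] ℍ[F, a, b] ⊗[F] ℍ[F, z, w])) := by
  have h2 : (2 : F) ≠ 0 := Ring.two_ne_zero hchar
  refine ⟨fun a b z w ha hb hz hw => part1 h2 ha hb hz hw, ?_⟩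
  intro A _ _ hc hs hdim he
  obtain ⟨e⟩ := he
  exact part2 h2 hdim e
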